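/- arXiv:1202.0504 — 2 statements merged into one kernel-verified Lean document; each statement's English description precedes it below -/
import Mathlib

section
/- Let P ⊆ ℝⁿ be a simple polygon with finitely many vertices and let p ∈ (0, 2). Then the intermediate energy of P is finite: I_p(P) < ∞. -/
open MeasureTheory Real
open scoped ENNReal NNReal Classical

/-- The Menger curvature of three points in `ℝⁿ`: the reciprocal of the circumradius,
`κ(x,y,z) = 2 dist(z, L_{x,y}) / (|x-z| |y-z|)` for pairwise distinct non-collinear points,
and `0` otherwise. -/
noncomputable def menger {n : ℕ} (x y z : EuclideanSpace ℝ (Fin n)) : ℝ :=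
  if x ≠ y ∧ y ≠ z ∧ x ≠ z ∧ ¬ Collinear ℝ ({x, y, z} : Set (EuclideanSpace ℝ (Fin n)))
  then 2 * Metric.infDist z (affineSpan ℝ ({x, y} : Set (EuclideanSpace ℝ (Fin n))) :
      Set (EuclideanSpace ℝ (Fin n))) / (dist x z * dist y z)
  else 0

/-- The point `(a, b) ∈ ℝ²` (with the Euclidean metric). -/
noncomputable def pt (a b : ℝ) : EuclideanSpace ℝ (Fin 2) :=
  (WithLp.equiv 2 (Fin 2 → ℝ)).symm ![a, b]

/-- Integral Menger curvature `M_p(X)` (innermost integration in `x`). -/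
noncomputable def Mp {n : ℕ} (p : ℝ) (X : Set (EuclideanSpace ℝ (Fin n))) : ℝ≥0∞ :=
  ∫⁻ z in X, ∫⁻ y in X, ∫⁻ x in X,
    (ENNReal.ofReal (menger x y z)) ^ p ∂μH[1] ∂μH[1] ∂μH[1]

/-- Intermediate energy `I_p(X)`. -/
noncomputable def Ip {n : ℕ} (p : ℝ) (X : Set (EuclideanSpace ℝ (Fin n))) : ℝ≥0∞ :=
  ∫⁻ y in X, ∫⁻ x in X,
    (⨆ z ∈ X, ENNReal.ofReal (menger x y z)) ^ p ∂μH[1] ∂μH[1]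

/-- Global curvature energy `U_p(X)`. -/
noncomputable def Up {n : ℕ} (p : ℝ) (X : Set (EuclideanSpace ℝ (Fin n))) : ℝ≥0∞ :=
  ∫⁻ x in X, (⨆ y ∈ X, ⨆ z ∈ X, ENNReal.ofReal (menger x y z)) ^ p ∂μH[1]

/-- `P ⊆ ℝⁿ` is a simple polygon with finitely many vertices: there are `N ≥ 3` vertices
`v 0, …, v (N-1)` (consecutive ones distinct) such that `P` is the union of the closed
segments `S i = [v i, v (i+1)]`, `i = 0, …, N-2`, consecutive segments meet exactly in their
common vertex, and non-adjacent segments are disjoint. -/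
def IsSimplePolygon {n : ℕ} (P : Set (EuclideanSpace ℝ (Fin n))) : Prop :=
  ∃ (N : ℕ) (v : ℕ → EuclideanSpace ℝ (Fin n)),
    3 ≤ N ∧
    (∀ i, i + 1 < N → v i ≠ v (i + 1)) ∧
    P = ⋃ i ∈ Finset.range (N - 1), segment ℝ (v i) (v (i + 1)) ∧
    (∀ i, i + 2 < N →
      segment ℝ (v i) (v (i + 1)) ∩ segment ℝ (v (i + 1)) (v (i + 2)) = {v (i + 1)}) ∧
    (∀ i j, i + 2 ≤ j → j + 1 < N →
      segment ℝ (v i) (v (i + 1)) ∩ segment ℝ (v j) (v (j + 1)) = ∅)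

section MengerCurvature

variable {n : ℕ} (x y z : EuclideanSpace ℝ (Fin n))

lemma menger_nonneg : 0 ≤ menger x y z := by
  unfold menger
  split_ifs
  · have := Metric.infDist_nonneg (x := z) (s := (affineSpan ℝ
      ({x, y} : Set (EuclideanSpace ℝ (Fin n))) : Set (EuclideanSpace ℝ (Fin n))))
    positivity
  · exact le_rfl

lemma menger_mul_dist_le_two_of_left : menger x y z * dist x z ≤ 2 := by
  unfold menger
  split_ifs with h
  · have hxz := dist_pos.2 h.2.2.1
    have hyz := dist_pos.2 h.2.1
    have hd := Metric.infDist_le_dist_of_mem (x := z) (right_mem_affineSpan_pair ℝ x y)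
    rw [dist_comm z y] at hd
    rw [div_mul_eq_mul_div, div_le_iff₀ (by positivity)]
    nlinarith
  · simp

lemma menger_mul_dist_le_two_of_right : menger x y z * dist y z ≤ 2 := by
  unfold menger
  split_ifs with h
  · have hxz := dist_pos.2 h.2.2.1
    have hyz := dist_pos.2 h.2.1
    have hd := Metric.infDist_le_dist_of_mem (x := z) (left_mem_affineSpan_pair ℝ x y)
    rw [dist_comm z x] at hd
    rw [div_mul_eq_mul_div, div_le_iff₀ (by positivity)]
    nlinarith
  · simp

/-- Twice the area of the triangle `x, y, z` is at most the product of two of its sides. -/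
lemma infDist_affineSpan_pair_mul_dist_le :
    Metric.infDist z (affineSpan ℝ ({x, y} : Set (EuclideanSpace ℝ (Fin n))) :
      Set (EuclideanSpace ℝ (Fin n))) * dist x y ≤ dist x z * dist y z := by
  rcases eq_or_ne x y with rfl | hxy
  · simp only [dist_self, mul_zero]; positivity
  set u := y - x
  set a := z - x
  have hu : 0 < ‖u‖ := norm_pos_iff.2 (sub_ne_zero.2 hxy.symm)
  set s : ℝ := inner ℝ a u / ‖u‖ ^ 2
  have hs : s * ‖u‖ ^ 2 = inner ℝ a u := by simp only [s]; field_simp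
  have hd := Metric.infDist_le_dist_of_mem (x := z)
    (AffineMap.lineMap_mem_affineSpan_pair (k := ℝ) s x y)
  have hfoot : dist z (AffineMap.lineMap x y s) = ‖a - s • u‖ := by
    rw [dist_eq_norm, AffineMap.lineMap_apply_module']
    congr 1
    simp only [a, u]
    abel
  have h1 : dist x z = ‖a‖ := by rw [dist_comm, dist_eq_norm]
  have h2 : dist y z = ‖a - u‖ := by
    rw [dist_comm, dist_eq_norm]; congr 1; simp only [a, u]; abel
  have h3 : dist x y = ‖u‖ := by rw [dist_comm, dist_eq_norm]
  have hsq1 : ‖a - s • u‖ ^ 2 = ‖a‖ ^ 2 - 2 * (s * inner ℝ a u) + s ^ 2 * ‖u‖ ^ 2 := by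
    rw [norm_sub_sq_real, inner_smul_right, norm_smul, mul_pow, Real.norm_eq_abs, sq_abs]
  have hsq2 := norm_sub_sq_real a u
  rw [hfoot] at hd
  rw [h1, h2, h3]
  refine (mul_le_mul_of_nonneg_right hd hu.le).trans ?_
  refine le_of_sq_le_sq ?_ (by positivity)
  rw [mul_pow, mul_pow, hsq1, hsq2, ← hs]
  have : (‖a‖ ^ 2 - 2 * (s * (s * ‖u‖ ^ 2)) + s ^ 2 * ‖u‖ ^ 2) * ‖u‖ ^ 2 + (‖a‖ ^ 2 -
      s * ‖u‖ ^ 2) ^ 2 = ‖a‖ ^ 2 * (‖a‖ ^ 2 - 2 * (s * ‖u‖ ^ 2) + ‖u‖ ^ 2) := by ring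
  nlinarith [sq_nonneg (‖a‖ ^ 2 - s * ‖u‖ ^ 2)]

lemma menger_mul_dist_le_two : menger x y z * dist x y ≤ 2 := by
  unfold menger
  split_ifs with h
  · have hxz := dist_pos.2 h.2.2.1
    have hyz := dist_pos.2 h.2.1
    have hd := infDist_affineSpan_pair_mul_dist_le x y z
    rw [div_mul_eq_mul_div, div_le_iff₀ (by positivity)]
    nlinarith
  · simp

lemma menger_eq_zero_of_mem_segment {x y z a b : EuclideanSpace ℝ (Fin n)}
    (hx : x ∈ segment ℝ a b) (hy : y ∈ segment ℝ a b) (hz : z ∈ segment ℝ a b) :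
    menger x y z = 0 := by
  have hsub : ∀ w ∈ segment ℝ a b, w ∈ affineSpan ℝ {a, b} := by
    intro w hw
    rw [segment_eq_image_lineMap] at hw
    obtain ⟨t, -, rfl⟩ := hw
    exact AffineMap.lineMap_mem_affineSpan_pair t a b
  exact if_neg fun h ↦ h.2.2.2
    (collinear_triple_of_mem_affineSpan_pair (hsub x hx) (hsub y hy) (hsub z hz))

end MengerCurvature

section Segments

variable {E : Type*} [NormedAddCommGroup E] [NormedSpace ℝ E]

lemma isCompact_segment_real (a b : E) : IsCompact (segment ℝ a b) := by
  rw [segment_eq_image']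
  exact isCompact_Icc.image (by fun_prop)

/-- Two segments that meet only in a common endpoint `w` enclose a positive angle. -/
lemma exists_dist_le_mul_dist_of_segment_inter_eq_singleton {w a b : E} (ha : a ≠ w)
    (hb : b ≠ w) (h : segment ℝ w a ∩ segment ℝ w b = {w}) :
    ∃ K : ℝ, 0 ≤ K ∧ ∀ x ∈ segment ℝ w a, ∀ z ∈ segment ℝ w b, dist x w ≤ K * dist x z := by
  set u := a - w
  set v := b - w
  have hu : u ≠ 0 := sub_ne_zero.2 ha
  have hv : v ≠ 0 := sub_ne_zero.2 hb
  have h0 : (0 : E) ∉ segment ℝ u (-v) := by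
    rintro ⟨s, t, hs, ht, hst, h0⟩
    have heq : s • u = t • v := by
      rw [smul_neg, ← sub_eq_add_neg, sub_eq_zero] at h0; exact h0
    have hmem : w + s • u ∈ segment ℝ w a ∩ segment ℝ w b := by
      constructor
      · rw [segment_eq_image']; exact ⟨s, ⟨hs, by linarith⟩, rfl⟩
      · rw [segment_eq_image']; exact ⟨t, ⟨ht, by linarith⟩, by simp only [heq]; rfl⟩
    rw [h, Set.mem_singleton_iff, add_eq_left, smul_eq_zero, or_iff_left hu] at hmem
    rw [hmem, zero_smul, eq_comm, smul_eq_zero, or_iff_left hv] at heq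
    linarith
  have hc := ((isCompact_segment_real u (-v)).isClosed.notMem_iff_infDist_pos ⟨u, left_mem_segment ℝ _ _⟩).1 h0
  set c := Metric.infDist (0 : E) (segment ℝ u (-v))
  refine ⟨‖u‖ / c, by positivity, fun x hx z hz ↦ ?_⟩
  rw [segment_eq_image'] at hx hz
  obtain ⟨s, ⟨hs, -⟩, rfl⟩ := hx
  obtain ⟨t, ⟨ht, -⟩, rfl⟩ := hz
  have hxw : dist (w + s • (a - w)) w = s * ‖u‖ := by
    rw [dist_eq_norm, add_sub_cancel_left, norm_smul, Real.norm_of_nonneg hs]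
  have hxz : dist (w + s • (a - w)) (w + t • (b - w)) = ‖s • u - t • v‖ := by
    rw [dist_eq_norm, add_sub_add_left_eq_sub]
  have key : (s + t) * c ≤ ‖s • u - t • v‖ := by
    rcases (add_nonneg hs ht).eq_or_lt with hst | hst
    · rw [← hst, zero_mul]; positivity
    have hmem : (s / (s + t)) • u + (t / (s + t)) • (-v) ∈ segment ℝ u (-v) :=
      ⟨_, _, by positivity, by positivity, by field_simp, rfl⟩
    have hle := Metric.infDist_le_dist_of_mem (x := (0 : E)) hmem
    rw [dist_zero_left] at hle
    have hsm : s • u - t • v = (s + t) • ((s / (s + t)) • u + (t / (s + t)) • (-v)) := by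
      rw [smul_add, smul_smul, smul_smul, mul_div_cancel₀ _ hst.ne', mul_div_cancel₀ _ hst.ne',
        smul_neg, sub_eq_add_neg]
    rw [hsm, norm_smul, Real.norm_of_nonneg hst.le]
    exact mul_le_mul_of_nonneg_left hle hst.le
  rw [hxw, hxz, div_mul_eq_mul_div, le_div_iff₀ hc]
  have := norm_nonneg u
  nlinarith [mul_nonneg ht hc.le]

/-- A point of a segment is controlled by its distance to any disjoint segment. -/
lemma exists_dist_le_mul_dist_of_disjoint_segment {a b c d : E}
    (h : Disjoint (segment ℝ a b) (segment ℝ c d)) :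
    ∃ K : ℝ, 0 ≤ K ∧ ∀ x ∈ segment ℝ a b, ∀ z ∈ segment ℝ c d, dist x a ≤ K * dist x z := by
  obtain ⟨r, hr, hlt⟩ := Metric.exists_pos_forall_lt_edist (isCompact_segment_real a b)
    (isCompact_segment_real c d).isClosed h
  have hsep : ∀ x ∈ segment ℝ a b, ∀ z ∈ segment ℝ c d, (r : ℝ) ≤ dist x z := fun x hx z hz ↦ by
    have := hlt x hx z hz
    rw [edist_nndist, ENNReal.coe_lt_coe] at this
    exact_mod_cast this.le
  have hr : (0 : ℝ) < r := hr
  refine ⟨dist a b / r, by positivity, fun x hx z hz ↦ ?_⟩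
  have h1 : dist x a ≤ dist a b := by
    rw [segment_eq_image'] at hx
    obtain ⟨s, hs, rfl⟩ := hx
    rw [dist_eq_norm, add_sub_cancel_left, norm_smul, Real.norm_of_nonneg hs.1, dist_comm,
      dist_eq_norm]
    exact mul_le_of_le_one_left (norm_nonneg _) hs.2
  rw [div_mul_eq_mul_div, le_div_iff₀ hr]
  exact mul_le_mul h1 (hsep x hx z hz) hr.le dist_nonneg

end Segments

section Integration

lemma setLIntegral_biUnion_finset_lt_top {α ι : Type*} [MeasurableSpace α] {μ : Measure α}
    (s : Finset ι) (S : ι → Set α) (f : α → ℝ≥0∞) (h : ∀ i ∈ s, ∫⁻ x in S i, f x ∂μ < ⊤) :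
    ∫⁻ x in ⋃ i ∈ s, S i, f x ∂μ < ⊤ := by
  induction s using Finset.induction_on with
  | empty => simp
  | insert a s _ ih =>
    rw [Finset.set_biUnion_insert]
    exact (lintegral_union_le _ _ _).trans_lt (ENNReal.add_lt_top.2
      ⟨h a (Finset.mem_insert_self a s), ih fun i hi ↦ h i (Finset.mem_insert_of_mem hi)⟩)

lemma setLIntegral_Ioc_inv_edist_rpow_lt_top {q : ℝ} (hq : q ∈ Set.Ioo (0 : ℝ) 1) (t₀ a b : ℝ) :
    ∫⁻ t in Set.Ioc a b, (edist t t₀)⁻¹ ^ q < ⊤ := by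
  have h1 : IntervalIntegrable (fun t : ℝ ↦ ‖(t : ℂ) ^ ((-q : ℝ) : ℂ)‖) volume
      (a - t₀) (b - t₀) :=
    (intervalIntegral.intervalIntegrable_cpow' (by simpa using hq.2)).norm
  have h2 := (h1.comp_sub_right t₀).1
  simp only [sub_add_cancel] at h2
  refine lt_of_eq_of_lt ?_ h2.2
  refine lintegral_congr_ae (ae_restrict_of_ae ?_)
  filter_upwards [Measure.ae_ne volume t₀] with t ht
  have hpos : 0 < |t - t₀| := abs_pos.2 (sub_ne_zero.2 ht)
  rw [enorm_norm, ← ofReal_norm, Complex.norm_cpow_real, edist_dist, Real.dist_eq,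
    Complex.norm_real, Real.norm_eq_abs, ← ENNReal.ofReal_rpow_of_pos hpos, ENNReal.rpow_neg,
    ENNReal.inv_rpow]

lemma setLIntegral_segment_inv_edist_rpow_lt_top {E : Type*} [NormedAddCommGroup E]
    [InnerProductSpace ℝ E] [MeasurableSpace E] [BorelSpace E] {q : ℝ}
    (hq : q ∈ Set.Ioo (0 : ℝ) 1) {a b : E} (hab : a ≠ b) (v : E) :
    ∫⁻ x in segment ℝ a b, (edist x v)⁻¹ ^ q ∂μH[1] < ⊤ := by
  have hL : 0 < ‖b - a‖ := norm_pos_iff.2 (sub_ne_zero.2 hab.symm)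
  set L := ‖b - a‖
  set u : E := L⁻¹ • (b - a)
  have hu : ‖u‖ = 1 := by
    simp only [u, norm_smul, norm_inv, Real.norm_of_nonneg hL.le]; exact inv_mul_cancel₀ hL.ne'
  set φ : ℝ → E := fun t ↦ a + t • u
  have hφ : Isometry φ := Isometry.of_dist_eq fun s t ↦ by
    simp only [φ, dist_eq_norm, add_sub_add_left_eq_sub, ← sub_smul, norm_smul, hu, mul_one]
  have hseg : segment ℝ a b ⊆ φ '' Set.Icc 0 L := by
    rw [segment_eq_image']
    rintro _ ⟨s, hs, rfl⟩
    refine ⟨s * L, ⟨by have := hs.1; positivity, mul_le_of_le_one_left hL.le hs.2⟩, ?_⟩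
    simp only [φ, u, smul_smul]
    rw [mul_assoc, mul_inv_cancel₀ hL.ne', mul_one]
  have hemb := hφ.isClosedEmbedding.measurableEmbedding
  set t₀ : ℝ := inner ℝ u (v - a)
  have hdist : ∀ t, edist t t₀ ≤ edist (φ t) v := by
    intro t
    rw [edist_dist, edist_dist]
    refine ENNReal.ofReal_le_ofReal ?_
    have hin : t - t₀ = inner ℝ u (φ t - v) := by
      have : φ t - v = t • u - (v - a) := by simp only [φ]; abel
      rw [this, inner_sub_right, inner_smul_right, real_inner_self_eq_norm_sq, hu]
      simp [t₀]
    rw [Real.dist_eq, hin, dist_eq_norm]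
    simpa [hu] using abs_real_inner_le_norm u (φ t - v)
  calc ∫⁻ x in segment ℝ a b, (edist x v)⁻¹ ^ q ∂μH[1]
      ≤ ∫⁻ x in φ '' Set.Icc 0 L, (edist x v)⁻¹ ^ q ∂μH[1] := lintegral_mono_set hseg
    _ = ∫⁻ x in φ '' Set.Icc 0 L, (edist x v)⁻¹ ^ q ∂(Measure.map φ volume) := by
        rw [← hausdorffMeasure_real, hφ.map_hausdorffMeasure (Or.inl zero_le_one),
          Measure.restrict_restrict_of_subset (Set.image_subset_range _ _)]
    _ = ∫⁻ t in Set.Icc 0 L, (edist (φ t) v)⁻¹ ^ q := by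
        rw [hemb.restrict_map, hemb.lintegral_map, Set.preimage_image_eq _ hφ.injective]
    _ ≤ ∫⁻ t in Set.Icc 0 L, (edist t t₀)⁻¹ ^ q :=
        lintegral_mono fun t ↦ ENNReal.rpow_le_rpow (ENNReal.inv_le_inv.2 (hdist t)) hq.1.le
    _ < ⊤ := by
        rw [← restrict_Ioc_eq_restrict_Icc]
        exact setLIntegral_Ioc_inv_edist_rpow_lt_top hq t₀ 0 L

end Integration

/-- If the curvature of all triples of points of `X` is at most `(w x * w y) ^ (1 / p)` for a
weight `w` that is integrable on `X`, then `X` has finite intermediate energy. -/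
lemma Ip_lt_top_of_forall_menger_rpow_le {n : ℕ} {X : Set (EuclideanSpace ℝ (Fin n))} {p : ℝ}
    (hp : 0 < p) (hX : MeasurableSet X) {w : EuclideanSpace ℝ (Fin n) → ℝ≥0∞} (hw : Measurable w)
    (hint : ∫⁻ x in X, w x ∂μH[1] < ⊤)
    (h : ∀ x ∈ X, ∀ y ∈ X, ∀ z ∈ X, ENNReal.ofReal (menger x y z) ^ p ≤ w x * w y) :
    Ip p X < ⊤ := by
  have hle : Ip p X ≤ ∫⁻ y in X, ∫⁻ x in X, w x * w y ∂μH[1] ∂μH[1] := by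
    refine setLIntegral_mono' hX fun y hy ↦ setLIntegral_mono' hX fun x hx ↦ ?_
    rw [← ENNReal.le_rpow_inv_iff hp]
    exact iSup₂_le fun z hz ↦ (ENNReal.le_rpow_inv_iff hp).2 (h x hx y hy z hz)
  refine hle.trans_lt ?_
  simp_rw [lintegral_mul_const _ hw]
  rw [lintegral_const_mul _ hw]
  exact ENNReal.mul_lt_top hint hint

lemma ofReal_le_mul_inv_edist {α : Type*} [PseudoMetricSpace α] {k C : ℝ} {x v : α} (hC : 0 < C)
    (h : k * dist x v ≤ C) : ENNReal.ofReal k ≤ ENNReal.ofReal C * (edist x v)⁻¹ := by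
  rw [← div_eq_mul_inv, ENNReal.le_div_iff_mul_le (Or.inr (by simpa using hC))
    (Or.inl (edist_ne_top _ _)), edist_dist, ← ENNReal.ofReal_mul' dist_nonneg]
  exact ENNReal.ofReal_le_ofReal h

/-- The distance of a point of a simple polygon to the set of vertices is controlled by its
distance to any segment not containing it. -/
lemma exists_vertex_dist_le_mul_dist {E : Type*} [NormedAddCommGroup E] [NormedSpace ℝ E] {N : ℕ}
    {v : ℕ → E} (hne : ∀ i, i + 1 < N → v i ≠ v (i + 1))
    (hadj : ∀ i, i + 2 < N →
      segment ℝ (v i) (v (i + 1)) ∩ segment ℝ (v (i + 1)) (v (i + 2)) = {v (i + 1)})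
    (hdisj : ∀ i j, i + 2 ≤ j → j + 1 < N →
      segment ℝ (v i) (v (i + 1)) ∩ segment ℝ (v j) (v (j + 1)) = ∅)
    {i j : ℕ} (hi : i + 1 < N) (hj : j + 1 < N) (hij : i ≠ j) :
    ∃ k < N, ∃ K : ℝ, 0 ≤ K ∧ ∀ x ∈ segment ℝ (v i) (v (i + 1)),
      ∀ z ∈ segment ℝ (v j) (v (j + 1)), dist x (v k) ≤ K * dist x z := by
  obtain rfl | rfl | h | h : j = i + 1 ∨ i = j + 1 ∨ i + 2 ≤ j ∨ j + 2 ≤ i := by lia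
  · have h := hadj i hj
    rw [segment_symm ℝ (v i)] at h ⊢
    exact ⟨i + 1, hi, exists_dist_le_mul_dist_of_segment_inter_eq_singleton
      (hne i hi) (hne (i + 1) hj).symm h⟩
  · have h := hadj j hi
    rw [segment_symm ℝ (v j), Set.inter_comm] at h
    rw [segment_symm ℝ (v j)]
    exact ⟨j + 1, hj, exists_dist_le_mul_dist_of_segment_inter_eq_singleton
      (hne (j + 1) hi).symm (hne j hj) h⟩
  · exact ⟨i, by lia, exists_dist_le_mul_dist_of_disjoint_segment
      (Set.disjoint_iff_inter_eq_empty.2 (hdisj i j h hj))⟩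
  · exact ⟨i, by lia, exists_dist_le_mul_dist_of_disjoint_segment
      (Set.disjoint_iff_inter_eq_empty.2 (by rw [Set.inter_comm]; exact hdisj j i h hi))⟩

/-- A version of `exists_vertex_dist_le_mul_dist` with a constant that works for all segments. -/
lemma exists_forall_vertex_dist_le_mul_dist {E : Type*} [NormedAddCommGroup E] [NormedSpace ℝ E]
    {N : ℕ} {v : ℕ → E} (hne : ∀ i, i + 1 < N → v i ≠ v (i + 1))
    (hadj : ∀ i, i + 2 < N →
      segment ℝ (v i) (v (i + 1)) ∩ segment ℝ (v (i + 1)) (v (i + 2)) = {v (i + 1)})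
    (hdisj : ∀ i j, i + 2 ≤ j → j + 1 < N →
      segment ℝ (v i) (v (i + 1)) ∩ segment ℝ (v j) (v (j + 1)) = ∅) :
    ∃ K : ℝ, 0 < K ∧ ∀ i j, i + 1 < N → j + 1 < N → i ≠ j → ∀ x ∈ segment ℝ (v i) (v (i + 1)),
      ∀ z ∈ segment ℝ (v j) (v (j + 1)), ∃ k < N, dist x (v k) ≤ K * dist x z := by
  have h : ∀ i j : ℕ, ∃ K : ℝ, 0 ≤ K ∧ (i + 1 < N → j + 1 < N → i ≠ j →
      ∀ x ∈ segment ℝ (v i) (v (i + 1)), ∀ z ∈ segment ℝ (v j) (v (j + 1)),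
        ∃ k < N, dist x (v k) ≤ K * dist x z) := by
    intro i j
    by_cases hc : i + 1 < N ∧ j + 1 < N ∧ i ≠ j
    · obtain ⟨k, hk, K, hK, h⟩ :=
        exists_vertex_dist_le_mul_dist hne hadj hdisj hc.1 hc.2.1 hc.2.2
      exact ⟨K, hK, fun _ _ _ x hx z hz ↦ ⟨k, hk, h x hx z hz⟩⟩
    · exact ⟨0, le_rfl, fun hi hj hij ↦ absurd ⟨hi, hj, hij⟩ hc⟩
  choose K hK0 hK using h
  have hsum : 0 ≤ ∑ i ∈ Finset.range N, ∑ j ∈ Finset.range N, K i j :=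
    Finset.sum_nonneg fun i _ ↦ Finset.sum_nonneg fun j _ ↦ hK0 i j
  refine ⟨1 + ∑ i ∈ Finset.range N, ∑ j ∈ Finset.range N, K i j, by linarith,
    fun i j hi hj hij x hx z hz ↦ ?_⟩
  obtain ⟨k, hk, hle⟩ := hK i j hi hj hij x hx z hz
  refine ⟨k, hk, hle.trans (mul_le_mul_of_nonneg_right ?_ dist_nonneg)⟩
  have h1 := Finset.single_le_sum (f := fun j ↦ K i j) (fun j _ ↦ hK0 i j)
    (Finset.mem_range.2 (show j < N by lia))
  have h2 := Finset.single_le_sum (f := fun i ↦ ∑ j ∈ Finset.range N, K i j)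
    (fun i _ ↦ Finset.sum_nonneg fun j _ ↦ hK0 i j) (Finset.mem_range.2 (show i < N by lia))
  linarith

/-- Every simple polygon has finite intermediate energy for `p ∈ (0,2)`. -/
theorem Ip_lt_top_of_isSimplePolygon {n : ℕ} (P : Set (EuclideanSpace ℝ (Fin n)))
    (hP : IsSimplePolygon P) (p : ℝ) (hp : p ∈ Set.Ioo (0:ℝ) 2) :
    Ip p P < ⊤ := by
  obtain ⟨N, v, -, hne, rfl, hadj, hdisj⟩ := hP
  obtain ⟨K, hK, hvert⟩ := exists_forall_vertex_dist_le_mul_dist hne hadj hdisj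
  have hq : p / 2 ∈ Set.Ioo (0 : ℝ) 1 := ⟨by linarith [hp.1], by linarith [hp.2]⟩
  set c : ℝ≥0∞ := ENNReal.ofReal (2 * K)
  set w : EuclideanSpace ℝ (Fin n) → ℝ≥0∞ := fun x ↦
    ∑ k ∈ Finset.range N, c ^ (p / 2) * (edist x (v k))⁻¹ ^ (p / 2)
  have hmeas : ∀ k, Measurable fun x ↦ (edist x (v k))⁻¹ ^ (p / 2) := fun k ↦ by fun_prop
  refine Ip_lt_top_of_forall_menger_rpow_le (w := w) hp.1 ?_ (by fun_prop) ?_ ?_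
  · refine Finset.measurableSet_biUnion _ fun i _ ↦
      (isCompact_segment_real _ _).measurableSet
  · refine setLIntegral_biUnion_finset_lt_top _ _ _ fun i hi ↦ ?_
    have hi : i + 1 < N := by have := Finset.mem_range.1 hi; lia
    simp only [w]
    rw [lintegral_finsetSum _ fun k _ ↦ (hmeas k).const_mul _]
    refine ENNReal.sum_lt_top.2 fun k _ ↦ ?_
    rw [lintegral_const_mul _ (hmeas k)]
    exact ENNReal.mul_lt_top (ENNReal.rpow_lt_top_of_nonneg hq.1.le ENNReal.ofReal_ne_top)
      (setLIntegral_segment_inv_edist_rpow_lt_top hq (hne i hi) (v k))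
  · have hmem : ∀ x ∈ ⋃ i ∈ Finset.range (N - 1), segment ℝ (v i) (v (i + 1)),
        ∃ i, i + 1 < N ∧ x ∈ segment ℝ (v i) (v (i + 1)) := by
      intro x hx
      obtain ⟨i, hi, hx⟩ := Set.mem_iUnion₂.1 hx
      exact ⟨i, by have := Finset.mem_range.1 hi; lia, hx⟩
    have hweight : ∀ {x κ k}, k < N → κ * dist x (v k) ≤ 2 * K →
        ENNReal.ofReal κ ^ (p / 2) ≤ w x := by
      intro x κ k hk h
      have h1 := ENNReal.rpow_le_rpow (ofReal_le_mul_inv_edist (by positivity) h) hq.1.le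
      rw [ENNReal.mul_rpow_of_nonneg _ _ hq.1.le] at h1
      exact h1.trans (Finset.single_le_sum
        (f := fun k ↦ c ^ (p / 2) * (edist x (v k))⁻¹ ^ (p / 2)) (fun _ _ ↦ zero_le)
        (Finset.mem_range.2 hk))
    have hbound : ∀ {x z κ i j}, 0 ≤ κ → i + 1 < N → j + 1 < N → i ≠ j →
        x ∈ segment ℝ (v i) (v (i + 1)) → z ∈ segment ℝ (v j) (v (j + 1)) →
        κ * dist x z ≤ 2 → ENNReal.ofReal κ ^ (p / 2) ≤ w x := by
      intro x z κ i j hκ hi hj hij hx hz h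
      obtain ⟨k, hk, hle⟩ := hvert i j hi hj hij x hx z hz
      refine hweight hk ((mul_le_mul_of_nonneg_left hle hκ).trans ?_)
      nlinarith
    intro x hx y hy z hz
    obtain ⟨i, hi, hx⟩ := hmem x hx
    obtain ⟨j, hj, hy⟩ := hmem y hy
    obtain ⟨k, hk, hz⟩ := hmem z hz
    have hκ := menger_nonneg x y z
    have hsplit : ENNReal.ofReal (menger x y z) ^ p =
        ENNReal.ofReal (menger x y z) ^ (p / 2) * ENNReal.ofReal (menger x y z) ^ (p / 2) := by
      rw [← ENNReal.rpow_add_of_nonneg _ _ hq.1.le hq.1.le, add_halves]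
    rw [hsplit]
    by_cases hij : i = j
    · subst hij
      by_cases hik : i = k
      · subst hik
        rw [menger_eq_zero_of_mem_segment hx hy hz]
        simp [hq.1]
      · exact mul_le_mul' (hbound hκ hi hk hik hx hz (menger_mul_dist_le_two_of_left x y z))
          (hbound hκ hi hk hik hy hz (menger_mul_dist_le_two_of_right x y z))
    · have h := menger_mul_dist_le_two x y z
      exact mul_le_mul' (hbound hκ hi hj hij hx hy h)
        (hbound hκ hj hi (Ne.symm hij) hy hx (by rwa [dist_comm]))
end

section
/- Let P ⊆ ℝⁿ be a simple polygon with finitely many vertices whose vertices are not all collinear (i.e., P is not contained in a straight line), and let p ≥ 3. Then the integral Menger curvature of P is infinite: M_p(P) = ∞. -/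
open MeasureTheory Real
open scoped ENNReal NNReal Classical

open Filter Topology

theorem exists_pos_le_norm_sub_smul {E : Type*} [NormedAddCommGroup E] [NormedSpace ℝ E]
    {a b : E} (hab : ∀ r : ℝ, b ≠ r • a) : ∃ d : ℝ, 0 < d ∧ ∀ r : ℝ, d ≤ ‖b - r • a‖ := by
  have hcl : IsClosed ((ℝ ∙ a : Submodule ℝ E) : Set E) := Submodule.closed_of_finiteDimensional _
  have hne : ((ℝ ∙ a : Submodule ℝ E) : Set E).Nonempty := ⟨0, Submodule.zero_mem _⟩
  refine ⟨Metric.infDist b (ℝ ∙ a : Submodule ℝ E), ?_, fun r => ?_⟩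
  · refine (hcl.notMem_iff_infDist_pos hne).1 fun h => ?_
    obtain ⟨r, hr⟩ := Submodule.mem_span_singleton.1 h
    exact hab r hr.symm
  · rw [← dist_eq_norm]
    exact Metric.infDist_le_dist_of_mem (Submodule.smul_mem _ r (Submodule.mem_span_singleton_self a))

theorem exists_pos_div_le_menger {n : ℕ} (O : EuclideanSpace ℝ (Fin n))
    {a b : EuclideanSpace ℝ (Fin n)} (hab : ∀ r : ℝ, b ≠ r • a) :
    ∃ c : ℝ, 0 < c ∧ ∀ u : ℝ, 0 < u → ∀ x ∈ segment ℝ O (O + u • a),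
      ∀ y ∈ segment ℝ O (O + u • a), x ≠ y → c / u ≤ menger x y (O + u • b) := by
  obtain ⟨d, hd, hdr⟩ := exists_pos_le_norm_sub_smul hab
  have hb : 0 < ‖b‖ := norm_pos_iff.2 fun h => hab 0 (by simp [h])
  have hs : 0 < ‖a‖ + ‖b‖ := by positivity
  refine ⟨2 * d / (‖a‖ + ‖b‖) ^ 2, by positivity, fun u hu x hx y hy hxy => ?_⟩
  set z := O + u • b with hz
  rw [segment_eq_image'] at hx hy
  obtain ⟨s, ⟨hs0, hs1⟩, rfl⟩ := hx
  obtain ⟨t, ⟨ht0, ht1⟩, rfl⟩ := hy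
  simp only [add_sub_cancel_left] at hxy ⊢
  set x := O + s • u • a with hx
  set y := O + t • u • a with hy
  have hline : ∀ w ∈ line[ℝ, x, y], u * d ≤ dist z w := by
    intro w hw
    obtain ⟨r, rfl⟩ := mem_affineSpan_pair_iff_exists_lineMap_eq.1 hw
    have hzw : z - AffineMap.lineMap x y r = u • (b - (s + r * (t - s)) • a) := by
      rw [AffineMap.lineMap_apply_module', hx, hy, hz]
      module
    rw [dist_eq_norm, hzw, norm_smul, Real.norm_of_nonneg hu.le]
    exact mul_le_mul_of_nonneg_left (hdr _) hu.le
  have hzline : z ∉ line[ℝ, x, y] := fun h => by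
    have := hline z h
    rw [dist_self] at this
    nlinarith [mul_pos hu hd]
  have hxz : x ≠ z := fun h => hzline (h ▸ left_mem_affineSpan_pair ℝ x y)
  have hyz : y ≠ z := fun h => hzline (h ▸ right_mem_affineSpan_pair ℝ x y)
  have hncol : ¬ Collinear ℝ ({x, y, z} : Set (EuclideanSpace ℝ (Fin n))) := fun h =>
    hzline (h.mem_affineSpan_of_mem_of_ne (by simp) (by simp) (by simp) hxy)
  have hdist : ∀ q : ℝ, 0 ≤ q → q ≤ 1 → dist (O + q • u • a) z ≤ u * (‖a‖ + ‖b‖) := by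
    intro q hq0 hq1
    rw [hz, dist_add_left, dist_eq_norm]
    refine (norm_sub_le _ _).trans ?_
    rw [norm_smul, norm_smul, norm_smul, Real.norm_of_nonneg hq0, Real.norm_of_nonneg hu.le]
    nlinarith [mul_nonneg hu.le (norm_nonneg a)]
  have hinf : u * d ≤ Metric.infDist z (line[ℝ, x, y] : Set (EuclideanSpace ℝ (Fin n))) :=
    (Metric.le_infDist ⟨x, left_mem_affineSpan_pair ℝ x y⟩).2 (fun {w} hw => hline w hw)
  rw [menger, if_pos ⟨hxy, hyz, hxz, hncol⟩]
  calc 2 * d / (‖a‖ + ‖b‖) ^ 2 / u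
      = 2 * (u * d) / ((u * (‖a‖ + ‖b‖)) * (u * (‖a‖ + ‖b‖))) := by field_simp
    _ ≤ _ := by
      have h1 := dist_pos.2 hxz
      have h2 := dist_pos.2 hyz
      have h3 := hdist s hs0 hs1
      have h4 := hdist t ht0 ht1
      have h5 : 0 ≤ Metric.infDist z (line[ℝ, x, y] : Set (EuclideanSpace ℝ (Fin n))) :=
        Metric.infDist_nonneg
      gcongr

theorem isClosed_segment_real {E : Type*} [NormedAddCommGroup E] [NormedSpace ℝ E] (x y : E) :
    IsClosed (segment ℝ x y) := by
  rw [segment_eq_image]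
  exact (isCompact_Icc.image (by fun_prop)).isClosed

theorem hausdorffMeasure_segment_add_smul_diff_singleton {n : ℕ}
    (O a w : EuclideanSpace ℝ (Fin n)) {u : ℝ} (hu : 0 ≤ u) :
    μH[1] (segment ℝ O (O + u • a) \ {w}) = ENNReal.ofReal (u * ‖a‖) := by
  have := Measure.nullSingletonClass_hausdorff (EuclideanSpace ℝ (Fin n)) (d := 1) one_pos
  rw [measure_sdiff_null (measure_singleton w), hausdorffMeasure_segment, edist_dist,
    dist_self_add_right, norm_smul, Real.norm_of_nonneg hu]

theorem ofReal_mul_le_setLIntegral_segment {n : ℕ} (O a w : EuclideanSpace ℝ (Fin n)) {u : ℝ}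
    (hu : 0 ≤ u) {P : Set (EuclideanSpace ℝ (Fin n))} (hP : segment ℝ O (O + u • a) ⊆ P)
    {f : EuclideanSpace ℝ (Fin n) → ℝ≥0∞} {m : ℝ≥0∞}
    (hf : ∀ x ∈ segment ℝ O (O + u • a), x ≠ w → m ≤ f x) :
    m * ENNReal.ofReal (u * ‖a‖) ≤ ∫⁻ x in P, f x ∂μH[1] := by
  rw [← hausdorffMeasure_segment_add_smul_diff_singleton O a w hu, ← setLIntegral_const]
  refine (setLIntegral_mono' ((isClosed_segment_real _ _).measurableSet.diff
    (measurableSet_singleton w)) fun x hx => hf x hx.1 hx.2).trans ?_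
  exact lintegral_mono_set (Set.sdiff_subset.trans hP)

theorem segment_add_smul_subset {E : Type*} [AddCommGroup E] [Module ℝ E] (O a : E) {u : ℝ}
    (hu0 : 0 ≤ u) (hu1 : u ≤ 1) : segment ℝ O (O + u • a) ⊆ segment ℝ O (O + a) := by
  refine (convex_segment _ _).segment_subset (left_mem_segment ℝ _ _) ?_
  rw [segment_eq_image']
  exact ⟨u, ⟨hu0, hu1⟩, by simp⟩

theorem Mp_eq_top_of_corner {n : ℕ} {P : Set (EuclideanSpace ℝ (Fin n))}
    (O : EuclideanSpace ℝ (Fin n)) {a b : EuclideanSpace ℝ (Fin n)} (ha : a ≠ 0)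
    (hab : ∀ r : ℝ, b ≠ r • a) (haP : segment ℝ O (O + a) ⊆ P) (hbP : segment ℝ O (O + b) ⊆ P)
    {p : ℝ} (hp : 3 ≤ p) : Mp p P = ⊤ := by
  obtain ⟨c, hc, hmenger⟩ := exists_pos_div_le_menger O hab
  have ha' : 0 < ‖a‖ := norm_pos_iff.2 ha
  have hb' : 0 < ‖b‖ := norm_pos_iff.2 fun h => hab 0 (by simp [h])
  set C : ℝ := c ^ p * ‖a‖ ^ 2 with hC
  have hC0 : 0 < C := by positivity
  set F : EuclideanSpace ℝ (Fin n) → ℝ≥0∞ := fun z =>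
    ∫⁻ y in P, ∫⁻ x in P, (ENNReal.ofReal (menger x y z)) ^ p ∂μH[1] ∂μH[1]
  have hFu : ∀ u : ℝ, 0 < u → u ≤ 1 → ENNReal.ofReal (C / u) ≤ F (O + u • b) := by
    intro u hu hu1
    have hsub := (segment_add_smul_subset O a hu.le hu1).trans haP
    have hle : ENNReal.ofReal (C / u) ≤
        ENNReal.ofReal (c / u) ^ p * ENNReal.ofReal (u * ‖a‖) * ENNReal.ofReal (u * ‖a‖) := by
      rw [ENNReal.ofReal_rpow_of_pos (by positivity), ← ENNReal.ofReal_mul (by positivity),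
        ← ENNReal.ofReal_mul (by positivity)]
      refine ENNReal.ofReal_le_ofReal ?_
      have hup : u ^ p ≤ u ^ 3 := by
        have := Real.rpow_le_rpow_of_exponent_ge hu hu1 hp
        exact_mod_cast this
      rw [Real.div_rpow hc.le hu.le, hC]
      calc c ^ p * ‖a‖ ^ 2 / u = c ^ p / u ^ 3 * (u * ‖a‖) * (u * ‖a‖) := by field_simp
        _ ≤ _ := by gcongr
    refine hle.trans (ofReal_mul_le_setLIntegral_segment O a O hu.le hsub fun y hy _ => ?_)
    refine ofReal_mul_le_setLIntegral_segment O a y hu.le hsub fun x hx hxy => ?_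
    exact ENNReal.rpow_le_rpow (ENNReal.ofReal_le_ofReal (hmenger u hu x hx y hy hxy))
      (by linarith)
  have hlower : ∀ ε : ℝ, 0 < ε → ε ≤ 1 →
      ENNReal.ofReal (C * ‖b‖) ≤ ∫⁻ z in segment ℝ O (O + ε • b), F z ∂μH[1] := by
    intro ε hε hε1
    have h := ofReal_mul_le_setLIntegral_segment O b O hε.le subset_rfl (f := F)
      (m := ENNReal.ofReal (C / ε)) ?_
    · rw [← ENNReal.ofReal_mul (by positivity)] at h
      convert h using 2
      field_simp
    · intro z hz hzO
      rw [segment_eq_image'] at hz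
      obtain ⟨s, ⟨hs0, hs1⟩, rfl⟩ := hz
      simp only [add_sub_cancel_left, smul_smul] at hzO ⊢
      have hs : 0 < s := hs0.lt_of_ne fun h => hzO (by simp [← h])
      have hsε : s * ε ≤ ε := by nlinarith
      refine le_trans (ENNReal.ofReal_le_ofReal ?_) (hFu (s * ε) (by positivity) (hsε.trans hε1))
      gcongr
  by_contra htop
  have htop' : ∫⁻ z in segment ℝ O (O + b), F z ∂μH[1] ≠ ⊤ :=
    ne_top_of_le_ne_top htop (lintegral_mono_set hbP)
  have hsmall : Tendsto (fun ε : ℝ => (μH[1].restrict (segment ℝ O (O + b)))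
      (segment ℝ O (O + ε • b))) (𝓝[>] 0) (𝓝 0) := by
    have hlim : Tendsto (fun ε : ℝ => ENNReal.ofReal (ε * ‖b‖)) (𝓝[>] 0) (𝓝 0) := by
      have : Continuous fun ε : ℝ => ENNReal.ofReal (ε * ‖b‖) :=
        ENNReal.continuous_ofReal.comp (continuous_mul_const _)
      have h0 := this.tendsto 0
      simp only [zero_mul, ENNReal.ofReal_zero] at h0
      exact h0.mono_left nhdsWithin_le_nhds
    refine tendsto_of_tendsto_of_tendsto_of_le_of_le' tendsto_const_nhds hlim
      (Eventually.of_forall fun _ => zero_le) ?_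
    filter_upwards [self_mem_nhdsWithin] with ε hε
    refine (Measure.restrict_apply_le _ _).trans_eq ?_
    rw [hausdorffMeasure_segment, edist_dist, dist_self_add_right, norm_smul,
      Real.norm_of_nonneg (le_of_lt hε)]
  have hzero := tendsto_setLIntegral_zero htop' hsmall
  have hle : ENNReal.ofReal (C * ‖b‖) ≤ 0 := by
    refine ge_of_tendsto hzero ?_
    filter_upwards [Ioc_mem_nhdsGT (zero_lt_one' ℝ)] with ε hε
    rw [Measure.restrict_restrict (isClosed_segment_real _ _).measurableSet,
      Set.inter_eq_left.2 (segment_add_smul_subset O b hε.1.le hε.2)]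
    exact hlower ε hε.1 hε.2
  exact absurd hle (by simpa using mul_pos hC0 hb')

theorem collinear_iUnion_segment {n N : ℕ} {v : ℕ → EuclideanSpace ℝ (Fin n)}
    (hne : ∀ i, i + 1 < N → v i ≠ v (i + 1))
    (hcol : ∀ i, i + 2 < N →
      Collinear ℝ ({v i, v (i + 1), v (i + 2)} : Set (EuclideanSpace ℝ (Fin n)))) :
    Collinear ℝ (⋃ i ∈ Finset.range (N - 1), segment ℝ (v i) (v (i + 1))) := by
  have hmem : ∀ i, i + 1 < N → v i ∈ line[ℝ, v 0, v 1] ∧ v (i + 1) ∈ line[ℝ, v 0, v 1] := by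
    intro i
    induction i with
    | zero => exact fun _ => ⟨left_mem_affineSpan_pair ℝ _ _, right_mem_affineSpan_pair ℝ _ _⟩
    | succ i ih =>
      intro hi
      obtain ⟨h1, h2⟩ := ih (by omega)
      exact ⟨h2, affineSpan_pair_le_of_mem_of_mem h1 h2 ((hcol i hi).mem_affineSpan_of_mem_of_ne
        (by simp) (by simp) (by simp) (hne i (by omega)))⟩
  have hline : Collinear ℝ (line[ℝ, v 0, v 1] : Set (EuclideanSpace ℝ (Fin n))) := by
    rw [Collinear, ← AffineSubspace.direction_eq_vectorSpan, direction_affineSpan]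
    exact collinear_pair ℝ (v 0) (v 1)
  refine hline.subset (Set.iUnion₂_subset fun i hi => ?_)
  obtain ⟨h1, h2⟩ := hmem i (by have := Finset.mem_range.1 hi; omega)
  exact (AffineSubspace.convex _).segment_subset h1 h2

/-- A simple polygon not contained in a straight line has infinite integral Menger
curvature for `p ≥ 3`. -/
theorem Mp_eq_top_of_isSimplePolygon {n : ℕ} (P : Set (EuclideanSpace ℝ (Fin n)))
    (hP : IsSimplePolygon P) (hcol : ¬ Collinear ℝ P) (p : ℝ) (hp : 3 ≤ p) :
    Mp p P = ⊤ := by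
  obtain ⟨N, v, -, hne, rfl, -, -⟩ := hP
  obtain ⟨i, hi, hncol⟩ : ∃ i, i + 2 < N ∧
      ¬ Collinear ℝ ({v i, v (i + 1), v (i + 2)} : Set (EuclideanSpace ℝ (Fin n))) := by
    by_contra! h
    exact hcol (collinear_iUnion_segment hne h)
  have hseg : ∀ j, j + 1 < N → segment ℝ (v j) (v (j + 1)) ⊆
      ⋃ i ∈ Finset.range (N - 1), segment ℝ (v i) (v (i + 1)) := fun j hj =>
    Set.subset_biUnion_of_mem (u := fun i => segment ℝ (v i) (v (i + 1)))
      (Finset.mem_coe.2 (Finset.mem_range.2 (by omega)))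
  refine Mp_eq_top_of_corner (v (i + 1)) (a := v i - v (i + 1)) (b := v (i + 2) - v (i + 1))
    (sub_ne_zero.2 (hne i (by omega))) (fun r hr => hncol ?_) ?_ ?_ hp
  · refine (collinear_iff_of_mem (p₀ := v (i + 1)) (by simp)).2 ⟨v i - v (i + 1), ?_⟩
    simp only [Set.mem_insert_iff, Set.mem_singleton_iff, vadd_eq_add]
    rintro q (rfl | rfl | rfl)
    · exact ⟨1, by simp⟩
    · exact ⟨0, by simp⟩
    · exact ⟨r, by simp [← hr]⟩
  · rw [add_sub_cancel, segment_symm]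
    exact hseg i (by omega)
  · rw [add_sub_cancel]
    exact hseg (i + 1) hi
end
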